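/- arXiv:1409.5033 — 4 statements merged into one kernel-verified Lean document; each statement's English description precedes it below -/
import Mathlib

section
/- Let d₁, d₂ be odd positive integers with d₁ ∣ d₂ and D = diag(d₁,d₂). Then for every R ∈ Γ_D, the entrywise reduction of R modulo 2 lies in Sp₄(ℤ/2ℤ), and the resulting group homomorphism r₂ : Γ_D → Sp₄(ℤ/2ℤ) is surjective. -/
open Matrix

/-- The matrix `J_D = [[0, D], [−D, 0]]` for `D = diag(d₁,d₂)`. -/
def JD (d1 d2 : ℤ) : Matrix (Fin 4) (Fin 4) ℤ :=
  !![0, 0, d1, 0; 0, 0, 0, d2; -d1, 0, 0, 0; 0, -d2, 0, 0]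

/-- The standard symplectic matrix `J = [[0, I₂], [−I₂, 0]]` over `ℤ/2ℤ`. -/
def Jmat2 : Matrix (Fin 4) (Fin 4) (ZMod 2) :=
  (JD 1 1).map (Int.cast)

/-- Membership in `Sp₄(ℤ/2ℤ)`. -/
def IsSp2 (N : Matrix (Fin 4) (Fin 4) (ZMod 2)) : Prop := N * Jmat2 * Nᵀ = Jmat2

/-- Entrywise reduction modulo 2 of an integer matrix. -/
def red2 (M : Matrix (Fin 4) (Fin 4) ℤ) : Matrix (Fin 4) (Fin 4) (ZMod 2) :=
  M.map (Int.cast)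

/-- Membership in the paramodular group `Γ_D`. -/
def InGammaD (d1 d2 : ℤ) (R : Matrix (Fin 4) (Fin 4) ℤ) : Prop :=
  R * JD d1 d2 * Rᵀ = JD d1 d2

set_option maxRecDepth 100000
set_option maxHeartbeats 1000000

def Good (d1 d2 : ℤ) (N : Matrix (Fin 4) (Fin 4) (ZMod 2)) : Prop :=
  ∃ R : Matrix (Fin 4) (Fin 4) ℤ, InGammaD d1 d2 R ∧ red2 R = N

theorem red2_mul (A B : Matrix (Fin 4) (Fin 4) ℤ) : red2 (A * B) = red2 A * red2 B :=
  Matrix.map_mul (f := Int.castRingHom (ZMod 2))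

theorem good_mul {d1 d2 : ℤ} {M N : Matrix (Fin 4) (Fin 4) (ZMod 2)}
    (hM : Good d1 d2 M) (hN : Good d1 d2 N) : Good d1 d2 (M * N) := by
  obtain ⟨R, hR, rfl⟩ := hM
  obtain ⟨S, hS, rfl⟩ := hN
  refine ⟨R * S, ?_, red2_mul R S⟩
  unfold InGammaD at *
  calc R * S * JD d1 d2 * (R * S)ᵀ = R * (S * JD d1 d2 * Sᵀ) * Rᵀ := by
        rw [Matrix.transpose_mul]; simp only [Matrix.mul_assoc]
    _ = _ := by rw [hS, hR]

/-- integer transvection -/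
def TZ (k a b c d : ℤ) : Matrix (Fin 4) (Fin 4) ℤ :=
  !![1 + a*(k*c), a*d, -(a*(k*a)), -(a*b);
     b*(k*c), 1 + b*d, -(b*(k*a)), -(b*b);
     c*(k*c), c*d, 1 - c*(k*a), -(c*b);
     d*(k*c), d*d, -(d*(k*a)), 1 - d*b]

def T2 (a b c d : ZMod 2) : Matrix (Fin 4) (Fin 4) (ZMod 2) :=
  !![1 + a*c, a*d, a*a, a*b;
     b*c, 1 + b*d, b*a, b*b;
     c*c, c*d, 1 + c*a, c*b;
     d*c, d*d, d*a, 1 + d*b]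

theorem TZ_mem (d1 k a b c d : ℤ) : InGammaD d1 (d1 * k) (TZ k a b c d) := by
  unfold InGammaD TZ JD
  ext i j
  fin_cases i <;> fin_cases j <;> simp [Matrix.mul_apply, Fin.sum_univ_four] <;> ring

theorem T2_good (d1 k : ℤ) (hk : Odd k) (a b c d : ZMod 2) : Good d1 (d1 * k) (T2 a b c d) := by
  obtain ⟨a, rfl⟩ := ZMod.intCast_surjective a
  obtain ⟨b, rfl⟩ := ZMod.intCast_surjective b
  obtain ⟨c, rfl⟩ := ZMod.intCast_surjective c
  obtain ⟨d, rfl⟩ := ZMod.intCast_surjective d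
  refine ⟨TZ k a b c d, TZ_mem _ _ _ _ _ _, ?_⟩
  have h : (k : ZMod 2) = 1 := (ZMod.intCast_eq_one_iff_odd).2 hk
  ext i j
  fin_cases i <;> fin_cases j <;> simp [red2, TZ, T2, h, CharTwo.neg_eq, CharTwo.sub_eq_add]

theorem T2_sq (a b c d : ZMod 2) : T2 a b c d * T2 a b c d = 1 := by
  revert a b c d; decide

theorem T2_sp (a b c d : ZMod 2) : IsSp2 (T2 a b c d) := by
  unfold IsSp2; revert a b c d; decide

theorem sp_mul {M N : Matrix (Fin 4) (Fin 4) (ZMod 2)}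
    (hR : IsSp2 M) (hS : IsSp2 N) : IsSp2 (M * N) := by
  unfold IsSp2 at *
  calc M * N * Jmat2 * (M * N)ᵀ = M * (N * Jmat2 * Nᵀ) * Mᵀ := by
        rw [Matrix.transpose_mul]; simp only [Matrix.mul_assoc]
    _ = _ := by rw [hS, hR]

def frm (x y : Fin 4 → ZMod 2) : ZMod 2 := x 0 * y 2 + x 1 * y 3 + x 2 * y 0 + x 3 * y 1

theorem sp_frm {N : Matrix (Fin 4) (Fin 4) (ZMod 2)} (h : IsSp2 N) (i j : Fin 4) :
    frm (N i) (N j) = Jmat2 i j := by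
  have := congrFun (congrFun h i) j
  rw [← this]
  simp [Jmat2, JD, frm, Matrix.mul_apply, Fin.sum_univ_four, CharTwo.neg_eq]
  ring

def act (a b c d : ZMod 2) (x : Fin 4 → ZMod 2) : Fin 4 → ZMod 2 :=
  let s := x 0 * a + x 1 * b + x 2 * c + x 3 * d
  ![x 0 + s * c, x 1 + s * d, x 2 + s * a, x 3 + s * b]

theorem mul_T2_row (N : Matrix (Fin 4) (Fin 4) (ZMod 2)) (a b c d : ZMod 2) (i : Fin 4) :
    (N * T2 a b c d) i = act a b c d (N i) := by
  ext j
  fin_cases j <;> simp [T2, act, Matrix.mul_apply, Fin.sum_univ_four] <;> ring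

theorem back {d1 k : ℤ} (hk : Odd k) {N : Matrix (Fin 4) (Fin 4) (ZMod 2)} (a b c d : ZMod 2)
    (h : Good d1 (d1 * k) (N * T2 a b c d)) : Good d1 (d1 * k) N := by
  have := good_mul h (T2_good d1 k hk a b c d)
  rwa [Matrix.mul_assoc, T2_sq, Matrix.mul_one] at this

theorem vec_eta (x : Fin 4 → ZMod 2) : x = ![x 0, x 1, x 2, x 3] := by
  ext i; fin_cases i <;> rfl

theorem lemA (x : Fin 4 → ZMod 2) (hx : x ≠ 0) : ∃ a b c d a' b' c' d' : ZMod 2,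
    act a b c d (act a' b' c' d' x) = ![1,0,0,0] := by
  rw [vec_eta x] at hx ⊢
  generalize x 0 = p, x 1 = q, x 2 = r, x 3 = s at *
  revert p q r s
  decide

theorem lemB (x : Fin 4 → ZMod 2) (hx : frm ![1,0,0,0] x = 1) :
    ∃ a b c d a' b' c' d' : ZMod 2,
    act a b c d (act a' b' c' d' ![1,0,0,0]) = ![1,0,0,0] ∧
    act a b c d (act a' b' c' d' x) = ![0,0,1,0] := by
  rw [vec_eta x] at hx ⊢
  generalize x 0 = p, x 1 = q, x 2 = r, x 3 = s at *
  revert p q r s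
  decide

theorem lemC (x y : Fin 4 → ZMod 2) (hx : frm ![1,0,0,0] x = 0) (hx' : frm ![0,0,1,0] x = 0)
    (hy : frm ![1,0,0,0] y = 0) (hy' : frm ![0,0,1,0] y = 0) (h : frm x y = 1) :
    ∃ b d b' d' : ZMod 2,
    act 0 b 0 d (act 0 b' 0 d' ![1,0,0,0]) = ![1,0,0,0] ∧
    act 0 b 0 d (act 0 b' 0 d' ![0,0,1,0]) = ![0,0,1,0] ∧
    act 0 b 0 d (act 0 b' 0 d' x) = ![0,1,0,0] ∧
    act 0 b 0 d (act 0 b' 0 d' y) = ![0,0,0,1] := by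
  have e1 : x 2 = 0 := by simpa [frm] using hx
  have e2 : x 0 = 0 := by simpa [frm] using hx'
  have e3 : y 2 = 0 := by simpa [frm] using hy
  have e4 : y 0 = 0 := by simpa [frm] using hy'
  rw [vec_eta x, vec_eta y] at h ⊢
  rw [e1, e2, e3, e4] at h ⊢
  generalize x 1 = p, x 3 = q, y 1 = r, y 3 = s at *
  clear hx hx' hy hy' e1 e2 e3 e4
  revert p q r s
  decide

theorem stepC {d1 k : ℤ} (hk : Odd k) {N : Matrix (Fin 4) (Fin 4) (ZMod 2)} (h : IsSp2 N)
    (h0 : N 0 = ![1,0,0,0]) (h2 : N 2 = ![0,0,1,0]) : Good d1 (d1 * k) N := by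
  have f1 := sp_frm h 0 1
  have f2 := sp_frm h 2 1
  have f3 := sp_frm h 0 3
  have f4 := sp_frm h 2 3
  have f5 := sp_frm h 1 3
  rw [h0] at f1 f3
  rw [h2] at f2 f4
  obtain ⟨b, d, b', d', g0, g2, g1, g3⟩ := lemC (N 1) (N 3) (f1.trans (by decide))
    (f2.trans (by decide)) (f3.trans (by decide)) (f4.trans (by decide)) (f5.trans (by decide))
  apply back hk 0 b' 0 d'
  apply back hk 0 b 0 d
  have : N * T2 0 b' 0 d' * T2 0 b 0 d = T2 0 0 0 0 := by
    funext i
    rw [mul_T2_row, mul_T2_row]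
    fin_cases i
    · exact (congrArg _ (congrArg _ h0)).trans (g0.trans (by decide))
    · exact g1.trans (by decide)
    · exact (congrArg _ (congrArg _ h2)).trans (g2.trans (by decide))
    · exact g3.trans (by decide)
  rw [this]
  exact T2_good d1 k hk _ _ _ _

theorem stepB {d1 k : ℤ} (hk : Odd k) {N : Matrix (Fin 4) (Fin 4) (ZMod 2)} (h : IsSp2 N)
    (h0 : N 0 = ![1,0,0,0]) : Good d1 (d1 * k) N := by
  have f1 := sp_frm h 0 2
  rw [h0] at f1
  obtain ⟨a, b, c, d, a', b', c', d', g0, g2⟩ := lemB (N 2) (f1.trans (by decide))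
  apply back hk a' b' c' d'
  apply back hk a b c d
  apply stepC hk (sp_mul (sp_mul h (T2_sp _ _ _ _)) (T2_sp _ _ _ _))
  · rw [mul_T2_row, mul_T2_row, h0, g0]
  · rw [mul_T2_row, mul_T2_row, g2]

theorem stepA {d1 k : ℤ} (hk : Odd k) {N : Matrix (Fin 4) (Fin 4) (ZMod 2)} (h : IsSp2 N) :
    Good d1 (d1 * k) N := by
  have f1 := sp_frm h 0 2
  obtain ⟨a, b, c, d, a', b', c', d', g0⟩ := lemA (N 0) (by
    intro h0
    rw [h0] at f1
    have : (0 : ZMod 2) = 1 := by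
      have e : Jmat2 0 2 = 1 := by decide
      rw [e] at f1
      simpa [frm] using f1
    exact absurd this (by decide))
  apply back hk a' b' c' d'
  apply back hk a b c d
  apply stepB hk (sp_mul (sp_mul h (T2_sp _ _ _ _)) (T2_sp _ _ _ _))
  rw [mul_T2_row, mul_T2_row, g0]

/-- For `d₁, d₂` odd positive integers with `d₁ ∣ d₂`, entrywise reduction modulo 2 maps
`Γ_D` into `Sp₄(ℤ/2ℤ)`, and the resulting group homomorphism `r₂ : Γ_D → Sp₄(ℤ/2ℤ)`
is surjective. -/
theorem statement1 (d1 d2 : ℤ) (h1 : Odd d1) (h1p : 0 < d1) (h2 : Odd d2) (h2p : 0 < d2)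
    (hdvd : d1 ∣ d2) :
    (∀ R : Matrix (Fin 4) (Fin 4) ℤ, InGammaD d1 d2 R → IsSp2 (red2 R)) ∧
    (∀ N : Matrix (Fin 4) (Fin 4) (ZMod 2), IsSp2 N →
      ∃ R : Matrix (Fin 4) (Fin 4) ℤ, InGammaD d1 d2 R ∧ red2 R = N) := by
  constructor
  · intro R hR
    have e : red2 (JD d1 d2) = Jmat2 := by
      have a1 : (d1 : ZMod 2) = 1 := (ZMod.intCast_eq_one_iff_odd).2 h1
      have a2 : (d2 : ZMod 2) = 1 := (ZMod.intCast_eq_one_iff_odd).2 h2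
      ext i j
      fin_cases i <;> fin_cases j <;> simp [red2, JD, Jmat2, a1, a2]
    have := congrArg red2 hR
    rw [red2_mul, red2_mul, e] at this
    exact this
  · intro N hN
    obtain ⟨k, rfl⟩ := hdvd
    exact stepA (Int.odd_mul.1 h2).2 hN
end

section
/- Let F = x₀x₂³ + x₂³x₄ − x₁³x₃ − x₁x₃³ + x₀³x₄ + x₀x₄³ ∈ ℂ[x₀,x₁,x₂,x₃,x₄]. Then the only common zero in ℂ⁵ of the five partial derivatives ∂F/∂x₀, …, ∂F/∂x₄ is the origin. Consequently the quartic threefold X₄³ = {F = 0} ⊂ ℙ⁴ over ℂ is smooth. -/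
open MvPolynomial

/-- The quartic `F = x₀x₂³ + x₂³x₄ − x₁³x₃ − x₁x₃³ + x₀³x₄ + x₀x₄³`. -/
noncomputable def Fpoly : MvPolynomial (Fin 5) ℂ :=
  X 0 * X 2 ^ 3 + X 2 ^ 3 * X 4 - X 1 ^ 3 * X 3 - X 1 * X 3 ^ 3 +
    X 0 ^ 3 * X 4 + X 0 * X 4 ^ 3

/-- The only common zero in `ℂ⁵` of the five partial derivatives of `F` is the origin;
consequently the quartic threefold `X₄³ = {F = 0} ⊂ ℙ⁴` is smooth. -/
theorem statement14 (v : Fin 5 → ℂ)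
    (h : ∀ i : Fin 5, eval v (pderiv i Fpoly) = 0) : v = 0 := by
  have key : ∀ x y : ℂ, y * (3 * x ^ 2 + y ^ 2) = 0 → x * (x ^ 2 + 3 * y ^ 2) = 0 →
      x = 0 ∧ y = 0 := by
    intro x y h1 h2
    have hx : x = 0 := by
      rcases mul_eq_zero.1 h1 with h3 | h3
      · subst h3
        have : x ^ 3 = 0 := by linear_combination h2
        exact pow_eq_zero_iff (by norm_num) |>.1 this
      · have : x ^ 3 = 0 := by linear_combination (3 / 8 : ℂ) * x * h3 - (1 / 8 : ℂ) * h2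
        exact pow_eq_zero_iff (by norm_num) |>.1 this
    subst hx
    have : y ^ 3 = 0 := by linear_combination h1
    exact ⟨rfl, pow_eq_zero_iff (by norm_num) |>.1 this⟩
  have h0 := h 0
  have h1 := h 1
  have h2 := h 2
  have h3 := h 3
  have h4 := h 4
  simp [Fpoly, pderiv_X, Pi.single_apply, Derivation.leibniz_pow] at h0 h1 h2 h3 h4
  obtain ⟨hb, hd⟩ := key (v 1) (v 3) (by linear_combination -h1) (by linear_combination -h3)
  have hc : v 2 ^ 2 * (v 0 + v 4) = 0 := by linear_combination (1 / 3 : ℂ) * h2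
  have hc0 : v 2 = 0 := by
    rcases mul_eq_zero.1 hc with h5 | h5
    · exact pow_eq_zero_iff (by norm_num) |>.1 h5
    · have ha : v 0 = - v 4 := by linear_combination h5
      rw [ha] at h0 h4
      have : v 2 ^ 3 = 0 := by linear_combination (1 / 2 : ℂ) * h0 + (1 / 2 : ℂ) * h4
      exact pow_eq_zero_iff (by norm_num) |>.1 this
  rw [hc0] at h0 h4
  obtain ⟨ha, he⟩ := key (v 0) (v 4) (by linear_combination h0) (by linear_combination h4)
  funext i
  fin_cases i <;> simp [ha, hb, hc0, hd, he]
end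

section
/- Let Δ = 2w₁⁴ − w₀³w₂ − w₀w₂³ ∈ ℂ[w₀,w₁,w₂]. Then the only common zero in ℂ³ of the three partial derivatives ∂Δ/∂w₀, ∂Δ/∂w₁, ∂Δ/∂w₂ is the origin; hence the plane quartic curve {Δ = 0} ⊂ ℙ² over ℂ is smooth (and in particular irreducible). -/
open MvPolynomial

/-- The quartic `Δ = 2w₁⁴ − w₀³w₂ − w₀w₂³` (variables `w₀,w₁,w₂` as indices `0,1,2`). -/
noncomputable def Dpoly : MvPolynomial (Fin 3) ℂ :=
  2 * X 1 ^ 4 - X 0 ^ 3 * X 2 - X 0 * X 2 ^ 3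

/-- The only common zero in `ℂ³` of the three partial derivatives of `Δ` is the origin;
hence the plane quartic curve `{Δ = 0} ⊂ ℙ²` is smooth (and in particular irreducible). -/
theorem statement17 (v : Fin 3 → ℂ)
    (h : ∀ i : Fin 3, eval v (pderiv i Dpoly) = 0) : v = 0 := by
  have h0 := h 0
  have h1 := h 1
  have h2 := h 2
  have e2 : (2 : MvPolynomial (Fin 3) ℂ) = C 2 := (map_ofNat C 2).symm
  simp only [Dpoly, e2, map_sub, Derivation.leibniz, Derivation.leibniz_pow, pderiv_X, pderiv_C]
    at h0 h1 h2
  simp at h0 h1 h2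
  have key : ∀ a c : ℂ, c * (3 * a ^ 2 + c ^ 2) = 0 → a * (a ^ 2 + 3 * c ^ 2) = 0 →
      a = 0 ∧ c = 0 := by
    intro a c h h'
    rcases mul_eq_zero.1 h with hc | hc
    · subst hc
      simpa using h'
    · rcases mul_eq_zero.1 h' with ha | ha
      · subst ha
        simpa using hc
      · have e1 : a ^ 2 = 0 := by linear_combination (3 / 8) * hc - (1 / 8) * ha
        have e2 : c ^ 2 = 0 := by linear_combination hc - 3 * e1
        exact ⟨by simpa using e1, by simpa using e2⟩
  obtain ⟨ha, hc⟩ := key (v 0) (v 2) (by linear_combination -h0) (by linear_combination -h2)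
  ext i
  fin_cases i
  · exact ha
  · simpa using h1
  · exact hc
end

section
/- Let Δ' = 2y₂⁸ − 14y₁⁵y₃³ − 14y₁³y₃⁵ − 2y₁⁷y₃ − 2y₁y₃⁷ ∈ ℂ[y₁,y₂,y₃]. Then the only common zero in ℂ³ of the three partial derivatives ∂Δ'/∂y₁, ∂Δ'/∂y₂, ∂Δ'/∂y₃ is the origin; hence {Δ' = 0} ⊂ ℙ² over ℂ is a smooth plane curve of degree eight. -/
open MvPolynomial

/-- The octic `Δ' = 2y₂⁸ − 14y₁⁵y₃³ − 14y₁³y₃⁵ − 2y₁⁷y₃ − 2y₁y₃⁷`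
(variables `y₁,y₂,y₃` as indices `0,1,2`). -/
noncomputable def Dpoly' : MvPolynomial (Fin 3) ℂ :=
  2 * X 1 ^ 8 - 14 * X 0 ^ 5 * X 2 ^ 3 - 14 * X 0 ^ 3 * X 2 ^ 5 -
    2 * X 0 ^ 7 * X 2 - 2 * X 0 * X 2 ^ 7

/-- The only common zero in `ℂ³` of the three partial derivatives of `Δ'` is the origin;
hence `{Δ' = 0} ⊂ ℙ²` is a smooth plane curve of degree eight. -/
theorem statement18 :
    (∀ v : Fin 3 → ℂ, (∀ i : Fin 3, eval v (pderiv i Dpoly') = 0) → v = 0) ∧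
    Dpoly'.totalDegree = 8 := by
  constructor
  · intro v h
    have h0 := h 0
    have h1 := h 1
    have h2 := h 2
    have c2 : (2 : MvPolynomial (Fin 3) ℂ) = C 2 := rfl
    have c14 : (14 : MvPolynomial (Fin 3) ℂ) = C 14 := rfl
    simp [Dpoly', c2, c14, pderiv_X, Derivation.leibniz,
      Derivation.leibniz_pow] at h0 h1 h2
    have e1 : (v 0 + v 2) ^ 7 = 0 := by linear_combination (-1/2) * h0 + (-1/2) * h2
    have e2 : (v 0 - v 2) ^ 7 = 0 := by linear_combination (1/2) * h0 + (-1/2) * h2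
    have f1 := pow_eq_zero_iff (by norm_num) |>.mp e1
    have f2 := pow_eq_zero_iff (by norm_num) |>.mp e2
    funext i
    fin_cases i
    · show v 0 = 0
      linear_combination (1/2) * f1 + (1/2) * f2
    · show v 1 = 0
      simpa using h1
    · show v 2 = 0
      linear_combination (1/2) * f1 - (1/2) * f2
  · have hX : ∀ i : Fin 3, (X i : MvPolynomial (Fin 3) ℂ).IsHomogeneous 1 :=
      fun i => isHomogeneous_X _ i
    have c2 : (2 : MvPolynomial (Fin 3) ℂ).IsHomogeneous 0 := isHomogeneous_C (Fin 3) (2 : ℂ)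
    have c14 : (14 : MvPolynomial (Fin 3) ℂ).IsHomogeneous 0 := isHomogeneous_C (Fin 3) (14 : ℂ)
    have hom : Dpoly'.IsHomogeneous 8 := by
      unfold Dpoly'
      refine IsHomogeneous.sub (IsHomogeneous.sub (IsHomogeneous.sub (IsHomogeneous.sub
        ?_ ?_) ?_) ?_) ?_
      · exact c2.mul ((hX 1).pow 8)
      · exact (c14.mul ((hX 0).pow 5)).mul ((hX 2).pow 3)
      · exact (c14.mul ((hX 0).pow 3)).mul ((hX 2).pow 5)
      · exact (c2.mul ((hX 0).pow 7)).mul (hX 2)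
      · exact (c2.mul (hX 0)).mul ((hX 2).pow 7)
    refine hom.totalDegree ?_
    intro hz
    have := congrArg (eval (![0, 1, 0] : Fin 3 → ℂ)) hz
    simp [Dpoly'] at this
end
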